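/- There is a constant C > 0, independent of T and ψ, such that for every T > 0 and every smooth function ψ on [0,T]×ℝ³ which is Schwartz in the space variable for each t, one has ‖∇ψ‖_{L⁴_T(L^∞(ℝ³))} ≤ C ‖∇_h∇ψ‖_{L²_T(H¹(ℝ³))}^{1/2} ‖∇ψ‖_{L^∞_T(H²(ℝ³))}^{1/2}. -/

import Mathlib

open MeasureTheory Real Set Filter
open scoped ENNReal NNReal

noncomputable section

/-- Spatial points of `ℝ³`. -/
abbrev Pt : Type := Fin 3 → ℝ

/-- Partial derivative in the `i`-th coordinate direction. -/
def pd (i : Fin 3) (f : Pt → ℝ) : Pt → ℝ := fun x => fderiv ℝ f x (Pi.single i 1)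

/-- Iterated partial derivative `∂^α` for a multi-index `α`. -/
def pdM (α : Fin 3 → ℕ) (f : Pt → ℝ) : Pt → ℝ :=
  (pd 0)^[α 0] ((pd 1)^[α 1] ((pd 2)^[α 2] f))

/-- Multi-indices of total degree at most `k`. -/
def midx (k : ℕ) : Finset (Fin 3 → ℕ) :=
  (Fintype.piFinset fun _ => Finset.range (k + 1)).filter fun α => ∑ i, α i ≤ k

/-- The `H^k` inner product `(f|g)_{H^k} = ∑_{|α| ≤ k} ∫ ∂^α f ∂^α g`. -/
def hInner (k : ℕ) (f g : Pt → ℝ) : ℝ := ∑ α ∈ midx k, ∫ x : Pt, pdM α f x * pdM α g x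

/-- The squared `H^k` norm. -/
def hSq (k : ℕ) (f : Pt → ℝ) : ℝ := hInner k f f

/-- The squared `L²` norm. -/
def l2Sq (f : Pt → ℝ) : ℝ := ∫ x : Pt, (f x) ^ 2

/-- The Laplacian. -/
def lapl (f : Pt → ℝ) : Pt → ℝ := fun x => ∑ i, pd i (pd i f) x

/-- Horizontal directions. -/
def hIdx : Finset (Fin 3) := {0, 1}

/-- `L^∞` norm in time over `[0,T]` of a (nonnegative) function of time. -/
def supT (T : ℝ) (g : ℝ → ℝ) : ℝ := sSup (g '' Icc 0 T)

/-- `L²` norm in time over `[0,T]`. -/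
def l2T (T : ℝ) (g : ℝ → ℝ) : ℝ := Real.sqrt (∫ t in (0:ℝ)..T, (g t) ^ 2)

/-- `L⁴` norm in time over `[0,T]`. -/
def l4T (T : ℝ) (g : ℝ → ℝ) : ℝ := (∫ t in (0:ℝ)..T, (g t) ^ 4) ^ ((1:ℝ)/4)

/-- A function is Schwartz: smooth with all derivatives rapidly decaying. -/
def IsSchwartz (f : Pt → ℝ) : Prop :=
  ContDiff ℝ (⊤ : ℕ∞) f ∧ ∀ k n : ℕ, ∃ C : ℝ, ∀ x, ‖x‖ ^ k * ‖iteratedFDeriv ℝ n f x‖ ≤ C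

/-- Smoothness of `f` jointly in `(t,x)` on `s ×ˢ ℝ³`. -/
def SmoothOn2 (s : Set ℝ) (f : ℝ → Pt → ℝ) : Prop :=
  ContDiffOn ℝ (⊤ : ℕ∞) (fun q : ℝ × Pt => f q.1 q.2) (s ×ˢ (univ : Set Pt))

/-- `‖∇f‖_{H^k}²`. -/
def gradHSq (k : ℕ) (f : Pt → ℝ) : ℝ := ∑ i, hSq k (pd i f)

/-- `‖∇_h∇f‖_{H^k}²`. -/
def gradHHSq (k : ℕ) (f : Pt → ℝ) : ℝ := ∑ i ∈ hIdx, ∑ j, hSq k (pd i (pd j f))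

/-- `‖v‖_{H^k}²` for a vector field. -/
def vecHSq (k : ℕ) (v : Fin 3 → Pt → ℝ) : ℝ := ∑ j, hSq k (v j)

/-- `‖∇v‖_{H^k}²` for a vector field. -/
def gradVecHSq (k : ℕ) (v : Fin 3 → Pt → ℝ) : ℝ := ∑ j, gradHSq k (v j)

/-- `B_T²`. -/
def BTsq (T : ℝ) (ψ : ℝ → Pt → ℝ) (v : Fin 3 → ℝ → Pt → ℝ) : ℝ :=
  (supT T fun t => Real.sqrt (vecHSq 2 fun j => v j t)) ^ 2
  + (supT T fun t => Real.sqrt (gradHSq 2 (ψ t))) ^ 2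
  + (l2T T fun t => Real.sqrt (gradVecHSq 2 fun j => v j t)) ^ 2
  + (l2T T fun t => Real.sqrt (gradHHSq 1 (ψ t))) ^ 2

/-- `B_T`. -/
def BT (T : ℝ) (ψ : ℝ → Pt → ℝ) (v : Fin 3 → ℝ → Pt → ℝ) : ℝ := Real.sqrt (BTsq T ψ v)

/-- The transport equation `∂_tψ + v·∇ψ + v₃ = 0` on `s × ℝ³`. -/
def TransportEq (s : Set ℝ) (ψ : ℝ → Pt → ℝ) (v : Fin 3 → ℝ → Pt → ℝ) : Prop :=
  ∀ t ∈ s, ∀ x, deriv (fun τ => ψ τ x) t + (∑ i, v i t x * pd i (ψ t) x) + v 2 t x = 0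

/-- Divergence-free condition on `s × ℝ³`. -/
def DivFree (s : Set ℝ) (v : Fin 3 → ℝ → Pt → ℝ) : Prop :=
  ∀ t ∈ s, ∀ x, (∑ i, pd i (fun y => v i t y) x) = 0

/-- The momentum equations of system (S) on `s × ℝ³`. -/
def MomentumEq (s : Set ℝ) (ψ : ℝ → Pt → ℝ) (v : Fin 3 → ℝ → Pt → ℝ)
    (p : ℝ → Pt → ℝ) : Prop :=
  ∀ j : Fin 3, ∀ t ∈ s, ∀ x,
    deriv (fun τ => v j τ x) t + (∑ i, v i t x * pd i (v j t) x) - lapl (v j t) x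
      + pd j (p t) x + pd j (pd 2 (ψ t)) x + (if j = 2 then lapl (ψ t) x else 0)
    = - ∑ i, pd i (fun y => pd j (ψ t) y * pd i (ψ t) y) x

/-- The full system (S) on `s × ℝ³`. -/
def SolvesS (s : Set ℝ) (ψ : ℝ → Pt → ℝ) (v : Fin 3 → ℝ → Pt → ℝ)
    (p : ℝ → Pt → ℝ) : Prop :=
  TransportEq s ψ v ∧ MomentumEq s ψ v p ∧ DivFree s v

/-- Finiteness of the four norms entering `B_T`. -/
def FiniteClass (T : ℝ) (ψ : ℝ → Pt → ℝ) (v : Fin 3 → ℝ → Pt → ℝ) : Prop :=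
  BddAbove ((fun t => Real.sqrt (vecHSq 2 fun j => v j t)) '' Icc 0 T) ∧
  BddAbove ((fun t => Real.sqrt (gradHSq 2 (ψ t))) '' Icc 0 T) ∧
  IntervalIntegrable (fun t => gradVecHSq 2 fun j => v j t) volume 0 T ∧
  IntervalIntegrable (fun t => gradHHSq 1 (ψ t)) volume 0 T

open SchwartzMap FourierTransform LineDeriv

/-- Three-dimensional Euclidean space, on which the Fourier transform acts. -/
abbrev Freq : Type := EuclideanSpace ℝ (Fin 3)

/-- The inclusion of real Schwartz functions on `Pt` into complex ones on Euclidean space. -/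
def toFreq (f : 𝓢(Pt, ℝ)) : 𝓢(Freq, ℂ) :=
  SchwartzMap.postcompCLM (𝕜 := ℝ) Complex.ofRealCLM
    (SchwartzMap.compCLMOfContinuousLinearEquiv ℝ (EuclideanSpace.equiv (Fin 3) ℝ) f)

lemma toFreq_apply (f : 𝓢(Pt, ℝ)) (x : Freq) : toFreq f x = (f (WithLp.ofLp x) : ℂ) := rfl

/-- The `i`-th partial derivative on Schwartz functions. -/
def schwartzPd (i : Fin 3) (f : 𝓢(Pt, ℝ)) : 𝓢(Pt, ℝ) := ∂_{(Pi.single i 1 : Pt)} f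

lemma coe_schwartzPd (i : Fin 3) (f : 𝓢(Pt, ℝ)) : ⇑(schwartzPd i f) = pd i f := by
  ext x
  exact SchwartzMap.lineDerivOp_apply_eq_fderiv _ _ _

lemma toFreq_schwartzPd (i : Fin 3) (f : 𝓢(Pt, ℝ)) :
    toFreq (schwartzPd i f) = ∂_{(EuclideanSpace.single i 1 : Freq)} (toFreq f) := by
  ext x
  rw [SchwartzMap.lineDerivOp_apply_eq_fderiv, toFreq_apply, coe_schwartzPd]
  have h2 : HasFDerivAt (⇑(toFreq f)) (Complex.ofRealCLM.comp ((fderiv ℝ f (WithLp.ofLp x)).comp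
      (EuclideanSpace.equiv (Fin 3) ℝ : Freq →L[ℝ] Pt))) x := by
    have h1 : HasFDerivAt f (fderiv ℝ f (WithLp.ofLp x)) (EuclideanSpace.equiv (Fin 3) ℝ x) :=
      (f.differentiable _).hasFDerivAt
    exact Complex.ofRealCLM.hasFDerivAt.comp x
      (h1.comp x (EuclideanSpace.equiv (Fin 3) ℝ : Freq →L[ℝ] Pt).hasFDerivAt)
  rw [h2.fderiv]
  rfl

lemma norm_sq_fourier_schwartzPd (i : Fin 3) (f : 𝓢(Pt, ℝ)) (ξ : Freq) :
    ‖𝓕 (toFreq (schwartzPd i f)) ξ‖ ^ 2 = (2 * π * ξ i) ^ 2 * ‖𝓕 (toFreq f) ξ‖ ^ 2 := by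
  have ht : (inner ℝ · (EuclideanSpace.single i 1 : Freq)).HasTemperateGrowth :=
    ((innerSL ℝ).flip (EuclideanSpace.single i 1 : Freq)).hasTemperateGrowth
  rw [toFreq_schwartzPd, SchwartzMap.fourier_lineDerivOp_eq, smul_apply,
    SchwartzMap.smulLeftCLM_apply_apply ht]
  simp only [norm_smul, mul_pow, norm_mul, EuclideanSpace.inner_single_right]
  simp [abs_of_pos Real.pi_pos]
  ring

lemma integral_sq_eq_integral_fourier (f : 𝓢(Pt, ℝ)) :
    ∫ x, f x * f x = ∫ ξ, ‖𝓕 (toFreq f) ξ‖ ^ 2 := by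
  rw [SchwartzMap.integral_norm_sq_fourier]
  rw [← (PiLp.volume_preserving_ofLp (Fin 3)).integral_comp
    (MeasurableEquiv.toLp 2 (Fin 3 → ℝ)).symm.measurableEmbedding (fun x => f x * f x)]
  refine integral_congr_ae (Eventually.of_forall fun x => ?_)
  simp [toFreq_apply, sq]

lemma integrable_norm_sq_fourier (f : 𝓢(Pt, ℝ)) :
    Integrable fun ξ => ‖𝓕 (toFreq f) ξ‖ ^ 2 :=
  ((𝓕 (toFreq f)).memLp 2).integrable_norm_pow (by norm_num)

lemma abs_le_integral_norm_fourier (f : 𝓢(Pt, ℝ)) (x : Pt) :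
    |f x| ≤ ∫ ξ, ‖𝓕 (toFreq f) ξ‖ := by
  have h : 𝓕⁻ (𝓕 (toFreq f)) = toFreq f := FourierTransform.fourierInv_fourier_eq _
  have h1 : |f x| = ‖𝓕⁻ (𝓕 (toFreq f)) (WithLp.toLp 2 x)‖ := by
    rw [h, toFreq_apply]; simp
  rw [h1, SchwartzMap.fourierInv_coe, Real.fourierInv_eq]
  refine (norm_integral_le_integral_norm _).trans_eq ?_
  simp [Circle.norm_smul]

lemma schwartzPd_iterate (i : Fin 3) (n : ℕ) (f : 𝓢(Pt, ℝ)) :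
    ⇑((schwartzPd i)^[n] f) = (pd i)^[n] f ∧ ∀ ξ, ‖𝓕 (toFreq ((schwartzPd i)^[n] f)) ξ‖ ^ 2 =
      (2 * π * ξ i) ^ (2 * n) * ‖𝓕 (toFreq f) ξ‖ ^ 2 := by
  induction n with
  | zero => simp
  | succ n ih =>
    simp only [Function.iterate_succ_apply', coe_schwartzPd, ih.1, norm_sq_fourier_schwartzPd,
      ih.2, true_and]
    intro ξ
    ring

/-- The Fourier symbol of the squared `H^k` norm. -/
def hSymbol (k : ℕ) (ξ : Freq) : ℝ :=
  ∑ α ∈ midx k, ∏ i, (2 * π * ξ i) ^ (2 * α i)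

lemma integral_hSymbol (k : ℕ) (f : 𝓢(Pt, ℝ)) :
    Integrable (fun ξ => hSymbol k ξ * ‖𝓕 (toFreq f) ξ‖ ^ 2) ∧
      ∫ ξ, hSymbol k ξ * ‖𝓕 (toFreq f) ξ‖ ^ 2 = hSq k f := by
  have key : ∀ α : Fin 3 → ℕ,
      Integrable (fun ξ : Freq => (∏ i, (2 * π * ξ i) ^ (2 * α i)) * ‖𝓕 (toFreq f) ξ‖ ^ 2) ∧
      ∫ ξ : Freq, (∏ i, (2 * π * ξ i) ^ (2 * α i)) * ‖𝓕 (toFreq f) ξ‖ ^ 2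
        = ∫ x, pdM α f x * pdM α f x := by
    intro α
    set g := (schwartzPd 0)^[α 0] ((schwartzPd 1)^[α 1] ((schwartzPd 2)^[α 2] f)) with hg
    have hcoe : ⇑g = pdM α f := by
      simp only [hg, pdM, (schwartzPd_iterate _ _ _).1]
    have hF : (fun ξ : Freq => (∏ i, (2 * π * ξ i) ^ (2 * α i)) * ‖𝓕 (toFreq f) ξ‖ ^ 2) =
        fun ξ => ‖𝓕 (toFreq g) ξ‖ ^ 2 := by
      ext ξ
      simp only [hg, (schwartzPd_iterate _ _ _).2, Fin.prod_univ_three]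
      ring
    rw [hF, ← hcoe]
    exact ⟨integrable_norm_sq_fourier g, (integral_sq_eq_integral_fourier g).symm⟩
  simp only [hSymbol, Finset.sum_mul]
  refine ⟨integrable_finsetSum _ fun α _ => (key α).1, ?_⟩
  rw [integral_finsetSum _ fun α _ => (key α).1]
  exact Finset.sum_congr rfl fun α _ => (key α).2

lemma hSymbol_one (ξ : Freq) : hSymbol 1 ξ = 1 + ∑ i, (2 * π * ξ i) ^ 2 := by
  have : midx 1 = {![0, 0, 0], ![1, 0, 0], ![0, 1, 0], ![0, 0, 1]} := by decide
  rw [hSymbol, this]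
  simp [Fin.prod_univ_three, Fin.sum_univ_three]
  ring

lemma le_hSymbol_two (ξ : Freq) : (1 + ∑ i, (2 * π * ξ i) ^ 2) ^ 2 ≤ 2 * hSymbol 2 ξ := by
  have : midx 2 = {![0, 0, 0], ![1, 0, 0], ![0, 1, 0], ![0, 0, 1], ![2, 0, 0], ![0, 2, 0],
      ![0, 0, 2], ![1, 1, 0], ![1, 0, 1], ![0, 1, 1]} := by decide
  rw [hSymbol, this]
  simp [Fin.prod_univ_three, Fin.sum_univ_three]
  generalize 2 * π * ξ 0 = a
  generalize 2 * π * ξ 1 = b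
  generalize 2 * π * ξ 2 = c
  nlinarith [sq_nonneg (a ^ 2), sq_nonneg (b ^ 2), sq_nonneg (c ^ 2)]

/-- The factors of the weight `∏ i, weight i (ξ i)`, which is integrable on `ℝ³` and satisfies
`1 ≤ (∏ i, weight i (ξ i))² |ξ_h|² (1 + |ξ|²)³`. -/
def weight (i : Fin 3) (s : ℝ) : ℝ :=
  if i = 2 then (1 + s ^ 2) ^ (-(3 / 4) : ℝ) else |s| ^ (-(1 / 2) : ℝ) * (1 + s ^ 2) ^ (-(3 / 8) : ℝ)

lemma integrable_of_integrableOn_Ioi_of_even {f : ℝ → ℝ} (hf : ∀ x, f (-x) = f x)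
    (h : IntegrableOn f (Ioi 0)) : Integrable f := by
  have hIic : IntegrableOn f (Iic 0) := by
    rw [← Measure.map_neg_eq_self (volume : Measure ℝ)]
    let m : MeasurableEmbedding fun x : ℝ => -x := (Homeomorph.neg ℝ).measurableEmbedding
    rw [m.integrableOn_map_iff]
    simp_rw [Function.comp_def, hf, neg_preimage, neg_Iic, neg_zero]
    exact Iff.mpr integrableOn_Ici_iff_integrableOn_Ioi h
  rw [← integrableOn_univ, ← Iic_union_Ioi (a := (0 : ℝ))]
  exact hIic.union h

lemma integrable_weight_horizontal :
    Integrable fun s : ℝ => |s| ^ (-(1 / 2) : ℝ) * (1 + s ^ 2) ^ (-(3 / 8) : ℝ) := by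
  refine integrable_of_integrableOn_Ioi_of_even (fun x => by simp) ?_
  have hmeas : Measurable fun s : ℝ => |s| ^ (-(1 / 2) : ℝ) * (1 + s ^ 2) ^ (-(3 / 8) : ℝ) := by
    fun_prop
  rw [← Ioc_union_Ioi_eq_Ioi (zero_le_one' ℝ)]
  refine IntegrableOn.union ?_ ?_
  · have h1 : IntegrableOn (fun s : ℝ => s ^ (-(1 / 2) : ℝ)) (Ioc 0 1) :=
      (intervalIntegrable_iff_integrableOn_Ioc_of_le zero_le_one).1
        (intervalIntegral.intervalIntegrable_rpow' (by norm_num))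
    refine h1.mono' hmeas.aestronglyMeasurable ?_
    refine (ae_restrict_iff' measurableSet_Ioc).2 (Eventually.of_forall fun s hs => ?_)
    rw [Real.norm_of_nonneg (by positivity), abs_of_pos hs.1]
    exact mul_le_of_le_one_right (rpow_nonneg hs.1.le _)
      (Real.rpow_le_one_of_one_le_of_nonpos (by nlinarith [sq_nonneg s]) (by norm_num))
  · have h1 : IntegrableOn (fun s : ℝ => s ^ (-(5 / 4) : ℝ)) (Ioi 1) :=
      integrableOn_Ioi_rpow_of_lt (by norm_num) one_pos
    refine h1.mono' hmeas.aestronglyMeasurable ?_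
    refine (ae_restrict_iff' measurableSet_Ioi).2 (Eventually.of_forall fun s hs => ?_)
    have hs0 : (0 : ℝ) < s := zero_lt_one.trans hs
    rw [Real.norm_of_nonneg (by positivity), abs_of_pos hs0]
    have h2 : (1 + s ^ 2) ^ (-(3 / 8) : ℝ) ≤ s ^ (-(3 / 4) : ℝ) := by
      have : s ^ (-(3 / 4) : ℝ) = (s ^ 2) ^ (-(3 / 8) : ℝ) := by
        rw [← Real.rpow_natCast_mul hs0.le]; norm_num
      rw [this]
      exact Real.rpow_le_rpow_of_nonpos (by positivity) (by linarith) (by norm_num)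
    calc s ^ (-(1 / 2) : ℝ) * (1 + s ^ 2) ^ (-(3 / 8) : ℝ)
        ≤ s ^ (-(1 / 2) : ℝ) * s ^ (-(3 / 4) : ℝ) := by gcongr
      _ = s ^ (-(5 / 4) : ℝ) := by rw [← Real.rpow_add hs0]; norm_num

lemma integrable_weight (i : Fin 3) : Integrable (weight i) := by
  unfold weight
  split_ifs
  · have := integrable_rpow_neg_one_add_norm_sq (E := ℝ) (μ := volume) (r := 3 / 2) (by norm_num)
    simp only [Real.norm_eq_abs, sq_abs] at this
    convert this using 3
    norm_num
  · exact integrable_weight_horizontal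

lemma weight_nonneg (i : Fin 3) (s : ℝ) : 0 ≤ weight i s := by
  unfold weight
  split_ifs <;> positivity

lemma integrable_prod_weight : Integrable fun ξ : Freq => ∏ i, weight i (ξ i) :=
  ((PiLp.volume_preserving_ofLp (Fin 3)).integrable_comp_emb
    (MeasurableEquiv.toLp 2 (Fin 3 → ℝ)).symm.measurableEmbedding).2
    (Integrable.fintype_prod integrable_weight)

lemma ae_coord_ne_zero (i : Fin 3) : ∀ᵐ ξ : Freq, ξ i ≠ 0 := by
  have h : ∀ᵐ s : ℝ, s ≠ 0 := by simp [ae_iff]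
  exact ((Measure.quasiMeasurePreserving_eval (fun _ : Fin 3 => (volume : Measure ℝ)) i).comp
    (PiLp.volume_preserving_ofLp (Fin 3)).quasiMeasurePreserving).ae h

/-- The Fourier symbol of `∑_{l ∈ {1,2}} ‖∂_l f‖_{H¹}²`. -/
def horizontalSymbol (ξ : Freq) : ℝ := ∑ l ∈ hIdx, (2 * π * ξ l) ^ 2 * hSymbol 1 ξ

lemma one_le_weight_mul_symbols {ξ : Freq} (h0 : ξ 0 ≠ 0) (h1 : ξ 1 ≠ 0) :
    1 ≤ (∏ i, weight i (ξ i)) ^ 2 * (horizontalSymbol ξ * (2 * hSymbol 2 ξ)) := by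
  have hη : ∀ i, ξ i ^ 2 ≤ (2 * π * ξ i) ^ 2 := fun i => by
    rw [mul_pow]
    exact le_mul_of_one_le_left (sq_nonneg _)
      (one_le_pow₀ (by linarith [Real.pi_gt_three]))
  have hhor : horizontalSymbol ξ =
      ((2 * π * ξ 0) ^ 2 + (2 * π * ξ 1) ^ 2) * (1 + ∑ i, (2 * π * ξ i) ^ 2) := by
    simp [horizontalSymbol, hIdx, hSymbol_one]
    ring
  set q : ℝ := 1 + ∑ i, ξ i ^ 2 with hq
  have hq1 : q ≤ 1 + ∑ i, (2 * π * ξ i) ^ 2 := by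
    exact add_le_add_right (Finset.sum_le_sum fun i _ => hη i) 1
  have hqi : ∀ i, 1 + ξ i ^ 2 ≤ q := fun i => by
    rw [hq]
    gcongr
    exact Finset.single_le_sum (f := fun i => ξ i ^ 2) (fun _ _ => sq_nonneg _) (Finset.mem_univ i)
  have hq0 : 0 < q := lt_of_lt_of_le (by positivity) (hqi 0)
  have hprod : |ξ 0| * |ξ 1| ≤ (2 * π * ξ 0) ^ 2 + (2 * π * ξ 1) ^ 2 := by
    nlinarith [hη 0, hη 1, sq_abs (ξ 0), sq_abs (ξ 1), sq_nonneg (|ξ 0| - |ξ 1|)]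
  have hsym : |ξ 0| * |ξ 1| * q ^ 3 ≤ horizontalSymbol ξ * (2 * hSymbol 2 ξ) := by
    have h2 : q ^ 2 ≤ 2 * hSymbol 2 ξ :=
      (pow_le_pow_left₀ hq0.le hq1 2).trans (le_hSymbol_two ξ)
    rw [hhor]
    calc |ξ 0| * |ξ 1| * q ^ 3 = |ξ 0| * |ξ 1| * q * q ^ 2 := by ring
      _ ≤ _ := by gcongr
  have hpow : ∀ i, ∀ p : ℝ, 0 ≤ p → (1 + ξ i ^ 2) ^ p ≤ q ^ p := fun i p hp =>
    Real.rpow_le_rpow (by positivity) (hqi i) hp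
  have hw : (∏ i, weight i (ξ i)) ^ 2 = (|ξ 0| * |ξ 1| * ((1 + ξ 0 ^ 2) ^ (3 / 4 : ℝ) *
      (1 + ξ 1 ^ 2) ^ (3 / 4 : ℝ) * (1 + ξ 2 ^ 2) ^ (3 / 2 : ℝ)))⁻¹ := by
    have hsq : ∀ (a : ℝ) (p : ℝ), 0 ≤ a → (a ^ (-p)) ^ 2 = (a ^ (2 * p))⁻¹ := fun a p ha => by
      rw [← Real.rpow_mul_natCast ha, ← Real.rpow_neg ha]
      congr 1; push_cast; ring
    have e0 : (0 : Fin 3) ≠ 2 := by decide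
    have e1 : (1 : Fin 3) ≠ 2 := by decide
    simp only [Fin.prod_univ_three, weight, if_neg e0, if_neg e1, if_true, mul_pow]
    rw [hsq _ _ (abs_nonneg _), hsq _ _ (abs_nonneg _), hsq _ _ (by positivity),
      hsq _ _ (by positivity), hsq _ _ (by positivity)]
    norm_num
    ring
  have hq3 : (1 + ξ 0 ^ 2) ^ (3 / 4 : ℝ) * (1 + ξ 1 ^ 2) ^ (3 / 4 : ℝ) *
      (1 + ξ 2 ^ 2) ^ (3 / 2 : ℝ) ≤ q ^ 3 := by
    calc _ ≤ q ^ (3 / 4 : ℝ) * q ^ (3 / 4 : ℝ) * q ^ (3 / 2 : ℝ) := by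
          gcongr ?_ * ?_ * ?_ <;> exact hpow _ _ (by norm_num)
      _ = q ^ 3 := by
          rw [← Real.rpow_add hq0, ← Real.rpow_add hq0, ← Real.rpow_natCast]; norm_num
  rw [hw, ← div_eq_inv_mul, one_le_div (by positivity)]
  exact le_trans (by gcongr) hsym

lemma integral_sqrt_mul_sqrt_sq_le {α : Type*} [MeasurableSpace α] {μ : Measure α} {u v : α → ℝ}
    (hu : Integrable u μ) (hv : Integrable v μ) (hu0 : ∀ x, 0 ≤ u x) (hv0 : ∀ x, 0 ≤ v x) :
    Integrable (fun x => √(u x) * √(v x)) μ ∧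
      (∫ x, √(u x) * √(v x) ∂μ) ^ 2 ≤ (∫ x, u x ∂μ) * ∫ x, v x ∂μ := by
  have hmem : ∀ {w : α → ℝ}, Integrable w μ → (∀ x, 0 ≤ w x) → MemLp (fun x => √(w x)) 2 μ := by
    intro w hw hw0
    rw [memLp_two_iff_integrable_sq
      (Real.continuous_sqrt.comp_aestronglyMeasurable hw.aestronglyMeasurable)]
    simpa only [Real.sq_sqrt (hw0 _)] using hw
  have hu2 := hmem hu hu0
  have hv2 := hmem hv hv0
  refine ⟨hu2.integrable_mul hv2, ?_⟩
  have h := integral_mul_le_Lp_mul_Lq_of_nonneg (μ := μ) Real.HolderConjugate.two_two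
    (Eventually.of_forall fun x => Real.sqrt_nonneg (u x))
    (Eventually.of_forall fun x => Real.sqrt_nonneg (v x)) (by simpa using hu2) (by simpa using hv2)
  simp only [Real.rpow_two, Real.sq_sqrt (hu0 _), Real.sq_sqrt (hv0 _),
    ← Real.sqrt_eq_rpow] at h
  refine (pow_le_pow_left₀ (integral_nonneg fun x => by positivity) h 2).trans_eq ?_
  rw [mul_pow, Real.sq_sqrt (integral_nonneg hu0), Real.sq_sqrt (integral_nonneg hv0)]

lemma hSymbol_nonneg (k : ℕ) (ξ : Freq) : 0 ≤ hSymbol k ξ :=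
  Finset.sum_nonneg fun _ _ => Finset.prod_nonneg fun _ _ =>
    Even.pow_nonneg (even_two_mul _) _

lemma integral_horizontalSymbol (f : 𝓢(Pt, ℝ)) :
    Integrable (fun ξ => horizontalSymbol ξ * ‖𝓕 (toFreq f) ξ‖ ^ 2) ∧
      ∫ ξ, horizontalSymbol ξ * ‖𝓕 (toFreq f) ξ‖ ^ 2 = ∑ l ∈ hIdx, hSq 1 (pd l f) := by
  have heq : (fun ξ => horizontalSymbol ξ * ‖𝓕 (toFreq f) ξ‖ ^ 2) = fun ξ =>
      ∑ l ∈ hIdx, hSymbol 1 ξ * ‖𝓕 (toFreq (schwartzPd l f)) ξ‖ ^ 2 := by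
    ext ξ
    simp only [horizontalSymbol, norm_sq_fourier_schwartzPd, Finset.sum_mul]
    exact Finset.sum_congr rfl fun _ _ => by ring
  rw [heq]
  refine ⟨integrable_finsetSum _ fun l _ => (integral_hSymbol 1 _).1, ?_⟩
  rw [integral_finsetSum _ fun l _ => (integral_hSymbol 1 _).1]
  simp only [(integral_hSymbol 1 _).2, coe_schwartzPd]

/-- The anisotropic Agmon inequality `‖f‖_{L^∞}⁴ ≤ C ‖∇_h f‖_{H¹}² ‖f‖_{H²}²`. -/
lemma anisotropic_agmon (f : 𝓢(Pt, ℝ)) (x : Pt) :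
    f x ^ 4 ≤ 2 * (∫ ξ : Freq, ∏ i, weight i (ξ i)) ^ 2 *
      ((∑ l ∈ hIdx, hSq 1 (pd l f)) * hSq 2 f) := by
  have hW0 : ∀ ξ : Freq, 0 ≤ ∏ i, weight i (ξ i) := fun ξ =>
    Finset.prod_nonneg fun i _ => weight_nonneg i _
  have hA0 : ∀ ξ : Freq, 0 ≤ horizontalSymbol ξ * ‖𝓕 (toFreq f) ξ‖ ^ 2 := fun ξ =>
    mul_nonneg (Finset.sum_nonneg fun l _ => mul_nonneg (sq_nonneg _) (hSymbol_nonneg 1 ξ))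
      (sq_nonneg _)
  have hB0 : ∀ ξ : Freq, 0 ≤ 2 * (hSymbol 2 ξ * ‖𝓕 (toFreq f) ξ‖ ^ 2) := fun ξ =>
    mul_nonneg zero_le_two (mul_nonneg (hSymbol_nonneg 2 ξ) (sq_nonneg _))
  obtain ⟨hA, hAeq⟩ := integral_horizontalSymbol f
  obtain ⟨hB, hBeq⟩ := integral_hSymbol 2 f
  obtain ⟨hv, hvle⟩ := integral_sqrt_mul_sqrt_sq_le hA (hB.const_mul 2) hA0 hB0
  obtain ⟨hu, hule⟩ := integral_sqrt_mul_sqrt_sq_le integrable_prod_weight hv hW0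
    fun ξ => by positivity
  rw [integral_const_mul, hAeq, hBeq] at hvle
  have hle : ∫ ξ, ‖𝓕 (toFreq f) ξ‖ ≤ ∫ ξ : Freq, √(∏ i, weight i (ξ i)) *
      √(√(horizontalSymbol ξ * ‖𝓕 (toFreq f) ξ‖ ^ 2) *
        √(2 * (hSymbol 2 ξ * ‖𝓕 (toFreq f) ξ‖ ^ 2))) := by
    refine integral_mono_ae (𝓕 (toFreq f)).integrable.norm hu ?_
    filter_upwards [ae_coord_ne_zero 0, ae_coord_ne_zero 1] with ξ h0 h1
    refine (pow_le_pow_iff_left₀ (norm_nonneg _) (by positivity) (four_ne_zero)).1 ?_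
    have hsqrt : ∀ a : ℝ, 0 ≤ a → √a ^ 4 = a ^ 2 := fun a ha => by
      rw [show 4 = 2 * 2 from rfl, pow_mul, Real.sq_sqrt ha]
    rw [mul_pow, hsqrt _ (hW0 ξ), hsqrt _ (by positivity), mul_pow, Real.sq_sqrt (hA0 ξ),
      Real.sq_sqrt (hB0 ξ)]
    calc ‖𝓕 (toFreq f) ξ‖ ^ 4 ≤ (∏ i, weight i (ξ i)) ^ 2 *
          (horizontalSymbol ξ * (2 * hSymbol 2 ξ)) * ‖𝓕 (toFreq f) ξ‖ ^ 4 :=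
        le_mul_of_one_le_left (by positivity) (one_le_weight_mul_symbols h0 h1)
      _ = _ := by ring
  have hf := (abs_le_integral_norm_fourier f x).trans hle
  calc f x ^ 4 = (|f x| ^ 2) ^ 2 := by rw [sq_abs]; ring
    _ ≤ _ := pow_le_pow_left₀ (sq_nonneg _)
        ((pow_le_pow_left₀ (abs_nonneg _) hf 2).trans hule) 2
    _ = _ := mul_pow _ _ 2
    _ ≤ _ := mul_le_mul_of_nonneg_left hvle (sq_nonneg _)
    _ = _ := by ring

lemma hSq_nonneg (k : ℕ) (f : Pt → ℝ) : 0 ≤ hSq k f :=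
  Finset.sum_nonneg fun _ _ => integral_nonneg fun _ => mul_self_nonneg _

lemma gradHSq_nonneg (k : ℕ) (f : Pt → ℝ) : 0 ≤ gradHSq k f :=
  Finset.sum_nonneg fun _ _ => hSq_nonneg _ _

lemma gradHHSq_nonneg (k : ℕ) (f : Pt → ℝ) : 0 ≤ gradHHSq k f :=
  Finset.sum_nonneg fun _ _ => Finset.sum_nonneg fun _ _ => hSq_nonneg _ _

lemma iSup_norm_grad_pow_four_le {f : Pt → ℝ} (hf : IsSchwartz f) :
    (⨆ x : Pt, √(∑ i, (pd i f x) ^ 2)) ^ 4 ≤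
      18 * (∫ ξ : Freq, ∏ i, weight i (ξ i)) ^ 2 * (gradHHSq 1 f * gradHSq 2 f) := by
  set K := 2 * (∫ ξ : Freq, ∏ i, weight i (ξ i)) ^ 2 * (gradHHSq 1 f * gradHSq 2 f) with hK
  have hK0 : 0 ≤ K := by
    have := gradHHSq_nonneg 1 f
    have := gradHSq_nonneg 2 f
    positivity
  let F : 𝓢(Pt, ℝ) := ⟨f, hf.1, hf.2⟩
  have hcomp : ∀ i x, pd i f x ^ 2 ≤ √K := by
    intro i x
    refine Real.le_sqrt_of_sq_le ?_
    have h := anisotropic_agmon (schwartzPd i F) x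
    rw [coe_schwartzPd, show ⇑F = f from rfl] at h
    rw [← pow_mul]
    refine h.trans ?_
    rw [hK]
    have h1 : ∑ l ∈ hIdx, hSq 1 (pd l (pd i f)) ≤ gradHHSq 1 f :=
      Finset.sum_le_sum fun l _ => Finset.single_le_sum (f := fun j => hSq 1 (pd l (pd j f)))
        (fun _ _ => hSq_nonneg _ _) (Finset.mem_univ i)
    have h2 : hSq 2 (pd i f) ≤ gradHSq 2 f :=
      Finset.single_le_sum (f := fun j => hSq 2 (pd j f))
        (fun _ _ => hSq_nonneg _ _) (Finset.mem_univ i)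
    exact mul_le_mul_of_nonneg_left
      (mul_le_mul h1 h2 (hSq_nonneg _ _) (gradHHSq_nonneg _ _)) (by positivity)
  have hsup : (⨆ x : Pt, √(∑ i, (pd i f x) ^ 2)) ≤ √(3 * √K) := by
    refine ciSup_le fun x => Real.sqrt_le_sqrt ?_
    refine (Finset.sum_le_sum fun i _ => hcomp i x).trans_eq ?_
    simp
  calc _ ≤ √(3 * √K) ^ 4 :=
        pow_le_pow_left₀ (Real.iSup_nonneg fun _ => Real.sqrt_nonneg _) hsup 4
    _ = 9 * K := by
        rw [show 4 = 2 * 2 from rfl, pow_mul, Real.sq_sqrt (by positivity), mul_pow,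
          Real.sq_sqrt hK0]
        norm_num
    _ = _ := by rw [hK]; ring

/-- Lemma 2.2, third inequality:
`‖∇ψ‖_{L⁴_T(L^∞)} ≤ C ‖∇_h∇ψ‖_{L²_T(H¹)}^{1/2} ‖∇ψ‖_{L^∞_T(H²)}^{1/2}`. -/
theorem stmt_3 :
    ∃ C : ℝ, 0 < C ∧ ∀ T : ℝ, 0 < T → ∀ ψ : ℝ → Pt → ℝ,
      SmoothOn2 (Icc 0 T) ψ → (∀ t ∈ Icc (0:ℝ) T, IsSchwartz (ψ t)) →
      BddAbove ((fun t => Real.sqrt (gradHSq 2 (ψ t))) '' Icc 0 T) →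
      IntervalIntegrable (fun t => gradHHSq 1 (ψ t)) volume 0 T →
      l4T T (fun t => ⨆ x : Pt, Real.sqrt (∑ i, (pd i (ψ t) x) ^ 2)) ≤
        C * (l2T T fun t => Real.sqrt (gradHHSq 1 (ψ t))) ^ ((1:ℝ)/2)
          * (supT T fun t => Real.sqrt (gradHSq 2 (ψ t))) ^ ((1:ℝ)/2) := by


  set K : ℝ := 18 * (∫ ξ : Freq, ∏ i, weight i (ξ i)) ^ 2 + 1 with hK
  have hK0 : 0 < K := by positivity
  refine ⟨K ^ ((1 : ℝ) / 4), by positivity, fun T hT ψ _ hψ hbdd hG => ?_⟩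
  set S := supT T fun t => √(gradHSq 2 (ψ t)) with hS
  have hS0 : 0 ≤ S := Real.sSup_nonneg (by rintro _ ⟨t, _, rfl⟩; positivity)
  set I := ∫ t in (0 : ℝ)..T, gradHHSq 1 (ψ t) with hI
  have hI0 : 0 ≤ I := intervalIntegral.integral_nonneg hT.le fun t _ => gradHHSq_nonneg _ _
  have hmain : ∫ t in (0 : ℝ)..T, (⨆ x : Pt, √(∑ i, (pd i (ψ t) x) ^ 2)) ^ 4 ≤ K * S ^ 2 * I := by
    rw [hI, ← intervalIntegral.integral_const_mul, intervalIntegral.integral_of_le hT.le,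
      intervalIntegral.integral_of_le hT.le]
    refine integral_mono_of_nonneg (Eventually.of_forall fun t => by positivity)
      (hG.const_mul (K * S ^ 2)).1 ?_
    refine (ae_restrict_iff' measurableSet_Ioc).2 (Eventually.of_forall fun t ht => ?_)
    have ht' : t ∈ Icc 0 T := Ioc_subset_Icc_self ht
    have h2 : gradHSq 2 (ψ t) ≤ S ^ 2 :=
      (Real.sqrt_le_left hS0).1 (le_csSup hbdd (mem_image_of_mem _ ht'))
    have h1 := gradHHSq_nonneg 1 (ψ t)
    calc _ ≤ _ := iSup_norm_grad_pow_four_le (hψ t ht')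
      _ ≤ K * (gradHHSq 1 (ψ t) * S ^ 2) := by
          have h3 := gradHSq_nonneg 2 (ψ t)
          refine mul_le_mul ?_ (mul_le_mul_of_nonneg_left h2 h1) (mul_nonneg h1 h3) hK0.le
          exact le_add_of_nonneg_right zero_le_one
      _ = _ := by ring
  have hl2 : l2T T (fun t => √(gradHHSq 1 (ψ t))) = √I := by
    simp only [l2T, Real.sq_sqrt (gradHHSq_nonneg _ _), hI]
  rw [hl2, Real.sqrt_eq_rpow, ← Real.rpow_mul hI0, l4T]
  refine (Real.rpow_le_rpow (intervalIntegral.integral_nonneg hT.le fun t _ => by positivity)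
    hmain (by norm_num)).trans_eq ?_
  rw [Real.mul_rpow (by positivity) hI0, Real.mul_rpow hK0.le (by positivity),
    ← Real.rpow_natCast_mul hS0]
  norm_num
  ring

end
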